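/- Tail behavior of normal scale mixtures with regularly varying mixing density (ψ₊ = 0 case): let λ < 1/2, let L: (0, ∞) → (0, ∞) be slowly varying at infinity (L(tx)/L(x) → 1 as x → ∞ for every t > 0), and let p: (0, ∞) → [0, ∞) be a measurable mixing density satisfying p(σ) / (σ^{λ−1} L(σ)) → 1 as σ → ∞. Define the normal scale mixture g(x) = ∫_0^∞ (2πσ)^{−1/2} exp(−x²/(2σ)) p(σ) dσ, assumed finite for all x ≠ 0. Then g(x) / [ (2π)^{−1/2} 2^{1/2−λ} Γ(1/2 − λ) |x|^{2λ−1} L(x²) ] → 1 as |x| → ∞. -/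

import Mathlib

open MeasureTheory Filter

lemma aux1 (h : ℝ → ℝ) (hm : Measurable h)
    (hs : ∀ u, Tendsto (fun x => h (x + u) - h x) atTop (nhds 0)) :
    ∃ X, ∀ x, X ≤ x → ∀ u, 0 ≤ u → u ≤ 1 → |h (x + u) - h x| ≤ 1 := by
  have hmeas : ∀ x : ℝ, Measurable (fun v => min 1 |h (x + v) - h x|) := by
    intro x; fun_prop
  have hint : ∀ x a b : ℝ, IntervalIntegrable (fun v => min 1 |h (x + v) - h x|) volume a b := by
    intro x a b
    rw [intervalIntegrable_iff]
    refine Measure.integrableOn_of_bounded (M := 1) (by simp) (hmeas x).aestronglyMeasurable ?_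
    refine Eventually.of_forall fun v => ?_
    rw [Real.norm_of_nonneg (by positivity)]
    exact min_le_left _ _
  have hf : Tendsto (fun x => ∫ v in (0:ℝ)..2, min 1 |h (x + v) - h x|) atTop (nhds 0) := by
    have := intervalIntegral.tendsto_integral_filter_of_dominated_convergence
      (μ := volume) (a := 0) (b := 2) (l := atTop)
      (F := fun (x:ℝ) v => min 1 |h (x + v) - h x|) (f := fun _ => (0:ℝ)) (fun _ => 1)
      (Eventually.of_forall fun x => (hmeas x).aestronglyMeasurable)
      (Eventually.of_forall fun x => Eventually.of_forall fun v _ => by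
        rw [Real.norm_of_nonneg (by positivity)]
        exact min_le_left _ _) (by simp)
      (Eventually.of_forall fun v _ => by
        have := (tendsto_const_nhds (x := (1:ℝ))).min (hs v).abs
        simpa using this)
    simpa using this
  obtain ⟨X, hX⟩ := eventually_atTop.1 (hf.eventually (gt_mem_nhds (show (0:ℝ) < 1/3 by norm_num)))
  refine ⟨X, fun x hx u hu0 hu1 => ?_⟩
  have h1 := hX x hx
  have h2 := hX (x + u) (by linarith)
  have e1 : ∫ v in (0:ℝ)..1, min 1 |h (x + u + v) - h (x + u)| ≤
      ∫ v in (0:ℝ)..2, min 1 |h (x + u + v) - h (x + u)| :=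
    intervalIntegral.integral_mono_interval le_rfl (by norm_num) (by norm_num)
      (Eventually.of_forall fun v => by simp; ) (hint _ _ _)
  have e2 : ∫ v in u..(1 + u), min 1 |h (x + v) - h x| ≤
      ∫ v in (0:ℝ)..2, min 1 |h (x + v) - h x| :=
    intervalIntegral.integral_mono_interval hu0 (by linarith) (by linarith)
      (Eventually.of_forall fun v => by simp) (hint _ _ _)
  have e3 : ∫ v in (0:ℝ)..1, min 1 |h (x + (v + u)) - h x| =
      ∫ v in u..(1 + u), min 1 |h (x + v) - h x| := by
    rw [intervalIntegral.integral_comp_add_right (fun v => min 1 |h (x + v) - h x|)]; simp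
  have i2 : IntervalIntegrable (fun v => min 1 |h (x + (v + u)) - h x|) volume 0 1 := by
    rw [intervalIntegrable_iff]
    refine Measure.integrableOn_of_bounded (M := 1) (by simp)
      (Measurable.aestronglyMeasurable (by fun_prop)) ?_
    refine Eventually.of_forall fun v => ?_
    rw [Real.norm_of_nonneg (by positivity)]
    exact min_le_left _ _
  have e4 : ∫ v in (0:ℝ)..1, min 1 |h (x + u) - h x| ≤
      ∫ v in (0:ℝ)..1, (min 1 |h (x + u + v) - h (x + u)| + min 1 |h (x + (v + u)) - h x|) := by
    refine intervalIntegral.integral_mono_on (by norm_num) (by simp) ((hint _ _ _).add i2) ?_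
    intro v _
    have e : x + (v + u) = x + u + v := by ring
    rw [e]
    have := abs_sub_le (h (x+u)) (h (x+u+v)) (h x)
    rw [abs_sub_comm (h (x+u)) (h (x+u+v))] at this
    have := abs_nonneg (h (x+u+v) - h (x+u))
    have := abs_nonneg (h (x+u+v) - h (x))
    rcases min_cases 1 |h (x+u+v) - h (x+u)| with ⟨a, _⟩ | ⟨a, _⟩ <;>
    rcases min_cases 1 |h (x+u+v) - h (x)| with ⟨b, _⟩ | ⟨b, _⟩ <;>
    rcases min_cases 1 |h (x+u) - h (x)| with ⟨c, _⟩ | ⟨c, _⟩ <;> rw [a, b, c] <;> linarith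
  rw [intervalIntegral.integral_add (hint _ _ _) i2, e3] at e4
  simp only [intervalIntegral.integral_const, sub_zero, one_smul] at e4
  by_contra! hc
  rw [min_eq_left hc.le] at e4
  linarith

lemma aux2 (h : ℝ → ℝ) (hm : Measurable h)
    (hs : ∀ u, Tendsto (fun x => h (x + u) - h x) atTop (nhds 0)) (δ : ℝ) (hδ : 0 < δ) :
    ∃ X, ∀ x, X ≤ x → ∀ u, 0 ≤ u → |h (x + u) - h x| ≤ 1 + δ * u := by
  obtain ⟨X1, h1⟩ := aux1 h hm hs
  obtain ⟨X2, h2⟩ := eventually_atTop.1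
    ((by simpa using (hs 1).abs : Tendsto (fun x => |h (x + 1) - h x|) atTop (nhds 0)).eventually
      (gt_mem_nhds hδ))
  have key : ∀ n : ℕ, ∀ x, max X1 X2 ≤ x → |h (x + n) - h x| ≤ δ * n := by
    intro n
    induction n with
    | zero => intro x _; simp
    | succ k ih =>
      intro x hx
      have a := ih x hx
      have b := h2 (x + k) (by have := le_max_right X1 X2; have : (0:ℝ) ≤ k := by positivity
                               linarith)
      have c := abs_sub_le (h (x + k + 1)) (h (x + k)) (h x)
      push_cast
      rw [← add_assoc]
      linarith
  refine ⟨max X1 X2, fun x hx u hu => ?_⟩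
  have a := key ⌊u⌋₊ x hx
  have f1 := Nat.floor_le hu
  have f2 := (Nat.lt_floor_add_one u).le
  have f3 : (0:ℝ) ≤ ⌊u⌋₊ := by positivity
  have b := h1 (x + ⌊u⌋₊) (by have := le_max_left X1 X2; linarith) (u - ⌊u⌋₊) (by linarith) (by linarith)
  rw [show x + ⌊u⌋₊ + (u - ⌊u⌋₊) = x + u by ring] at b
  have c := abs_sub_le (h (x + u)) (h (x + ⌊u⌋₊)) (h x)
  have d : δ * ⌊u⌋₊ ≤ δ * u := by gcongr
  linarith

lemma potter (L : ℝ → ℝ) (hL_meas : Measurable L) (hL_pos : ∀ x : ℝ, 0 < x → 0 < L x)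
    (hL_slow : ∀ t : ℝ, 0 < t → Tendsto (fun x : ℝ => L (t * x) / L x) atTop (nhds 1))
    (δ : ℝ) (hδ : 0 < δ) :
    ∃ X, 1 ≤ X ∧ ∀ a b, X ≤ a → X ≤ b →
      L b / L a ≤ Real.exp 1 * ((b / a) ^ δ + (b / a) ^ (-δ)) := by
  obtain ⟨X, hX⟩ := aux2 (fun x => Real.log (L (Real.exp x))) (by fun_prop) (by
    intro u
    have h1 := (hL_slow (Real.exp u) (Real.exp_pos u)).comp Real.tendsto_exp_atTop
    have h2 := h1.log one_ne_zero
    rw [Real.log_one] at h2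
    refine h2.congr fun x => ?_
    simp only [Function.comp]
    rw [Real.log_div (hL_pos _ (by positivity)).ne' (hL_pos _ (by positivity)).ne', ← Real.exp_add,
      add_comm]) δ hδ
  refine ⟨max 1 (Real.exp X), le_max_left _ _, fun a b ha hb => ?_⟩
  have ha0 : 0 < a := lt_of_lt_of_le one_pos ((le_max_left _ _).trans ha)
  have hb0 : 0 < b := lt_of_lt_of_le one_pos ((le_max_left _ _).trans hb)
  have ha1 : X ≤ Real.log a := (Real.le_log_iff_exp_le ha0).2 ((le_max_right _ _).trans ha)
  have hb1 : X ≤ Real.log b := (Real.le_log_iff_exp_le hb0).2 ((le_max_right _ _).trans hb)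
  have hLa := hL_pos a ha0
  have hLb := hL_pos b hb0
  have hba : 0 < b / a := by positivity
  rw [← Real.exp_log (div_pos hLb hLa), Real.log_div hLb.ne' hLa.ne', Real.rpow_def_of_pos hba,
    Real.rpow_def_of_pos hba, Real.log_div hb0.ne' ha0.ne', mul_add, ← Real.exp_add, ← Real.exp_add]
  rcases le_total (Real.log a) (Real.log b) with h | h
  · have := (abs_le.1 (hX _ ha1 (Real.log b - Real.log a) (by linarith))).2
    rw [show Real.log a + (Real.log b - Real.log a) = Real.log b by ring, Real.exp_log ha0,
      Real.exp_log hb0] at this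
    refine le_add_of_le_of_nonneg (Real.exp_le_exp.2 (by linarith)) (by positivity)
  · have := (abs_le.1 (hX _ hb1 (Real.log a - Real.log b) (by linarith))).1
    rw [show Real.log b + (Real.log a - Real.log b) = Real.log a by ring, Real.exp_log ha0,
      Real.exp_log hb0] at this
    refine le_add_of_nonneg_of_le (by positivity) (Real.exp_le_exp.2 (by linarith))

lemma gint (s : ℝ) (hs : 0 < s) :
    ∫ u in Set.Ioi (0:ℝ), u ^ (-s - 1) * Real.exp (-1 / (2 * u)) = 2 ^ s * Real.Gamma s := by
  have h := integral_comp_rpow_Ioi (fun v : ℝ => v ^ (s - 1) * Real.exp (-(1/2 * v)))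
    (p := -1) (by norm_num)
  rw [Real.integral_rpow_mul_exp_neg_mul_Ioi hs (by norm_num)] at h
  norm_num at h
  rw [← h]
  refine setIntegral_congr_fun measurableSet_Ioi fun u hu => ?_
  have hu : 0 < u := hu
  rw [← mul_assoc, ← Real.rpow_mul hu.le, ← Real.rpow_natCast, ← Real.rpow_neg hu.le,
    ← Real.rpow_add hu, Real.rpow_neg_one]
  congr 2
  · push_cast; ring
  · field_simp

lemma gintble (s : ℝ) (hs : 0 < s) :
    IntegrableOn (fun u : ℝ => u ^ (-s - 1) * Real.exp (-1 / (2 * u))) (Set.Ioi (0:ℝ)) := by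
  by_contra hc
  have h := gint s hs
  rw [integral_undef hc] at h
  have := Real.Gamma_pos_of_pos hs
  have : 0 < (2:ℝ) ^ s * Real.Gamma s := by positivity
  linarith

lemma partB (lam : ℝ) (L : ℝ → ℝ) (hL_pos : ∀ x : ℝ, 0 < x → 0 < L x)
    (hL_slow : ∀ t : ℝ, 0 < t → Tendsto (fun x : ℝ => L (t * x) / L x) atTop (nhds 1))
    (p : ℝ → ℝ) (hp_meas : Measurable p)
    (hp_tail : Tendsto (fun σ : ℝ => p σ / (σ ^ (lam - 1) * L σ)) atTop (nhds 1))
    (M δ : ℝ) (hM : 1 ≤ M) (hδ : 0 < δ) (hδ' : δ < 1 / 2 - lam)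
    (hq : ∀ σ, M ≤ σ → |p σ / (σ ^ (lam - 1) * L σ)| ≤ 2)
    (hpot : ∀ a b, M ≤ a → M ≤ b →
      L b / L a ≤ Real.exp 1 * ((b / a) ^ δ + (b / a) ^ (-δ))) :
    Tendsto (fun y : ℝ => (∫ σ in Set.Ioi M,
      (2 * Real.pi * σ) ^ (-(1 : ℝ) / 2) * Real.exp (-y / (2 * σ)) * p σ) /
        (y ^ (lam - 1 / 2) * L y)) atTop
      (nhds ((2 * Real.pi) ^ (-(1 : ℝ) / 2) *
        (2 ^ ((1 : ℝ) / 2 - lam) * Real.Gamma (1 / 2 - lam)))) := by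
  have hpi := Real.pi_pos
  set c : ℝ := (2 * Real.pi) ^ (-(1 : ℝ) / 2) with hc
  have hc0 : 0 < c := by positivity
  set H : ℝ → ℝ → ℝ := fun y u => (Set.Ioi (M / y)).indicator (fun u =>
    (2 * Real.pi * (y * u)) ^ (-(1 : ℝ) / 2) * Real.exp (-y / (2 * (y * u))) * p (y * u) * y /
      (y ^ (lam - 1 / 2) * L y)) u with hH
  -- closed form of H
  have hform : ∀ y u, 0 < y → M / y < u → H y u =
      c * (u ^ (-(1 / 2 - lam) - 1) * Real.exp (-1 / (2 * u))) *
      (p (y * u) / ((y * u) ^ (lam - 1) * L (y * u)) * (L (y * u) / L y)) := by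
    intro y u hy hu
    have hu0 : 0 < u := lt_trans (by positivity) hu
    have hLy := hL_pos y hy
    have hLyu := hL_pos (y * u) (by positivity)
    generalize L (y * u) = ℓ at *
    simp only [hH]
    rw [Set.indicator_of_mem (show u ∈ Set.Ioi (M / y) from hu)]
    rw [Real.mul_rpow (by positivity) (by positivity), ← hc,
      show -y / (2 * (y * u)) = -1 / (2 * u) by field_simp,
      Real.mul_rpow hy.le hu0.le, Real.mul_rpow hy.le hu0.le,
      show -(1 / 2 - lam) - 1 = (-(1:ℝ) / 2) + (lam - 1) by ring, Real.rpow_add hu0,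
      show lam - 1 / 2 = (-(1:ℝ) / 2) + (lam - 1) + 1 by ring, Real.rpow_add hy, Real.rpow_add hy,
      Real.rpow_one]
    have := Real.rpow_pos_of_pos hy (-1 / 2)
    have := Real.rpow_pos_of_pos hy (lam - 1)
    have := Real.rpow_pos_of_pos hu0 (-1 / 2)
    have := Real.rpow_pos_of_pos hu0 (lam - 1)
    field_simp
  have hint : Tendsto (fun y => ∫ u in Set.Ioi (0:ℝ), H y u) atTop
      (nhds (∫ u in Set.Ioi (0:ℝ), c * (u ^ (-(1 / 2 - lam) - 1) * Real.exp (-1 / (2 * u))))) := by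
    refine tendsto_integral_filter_of_dominated_convergence
      (fun u => c * 2 * Real.exp 1 * (u ^ (-(1 / 2 - lam - δ) - 1) * Real.exp (-1 / (2 * u)) +
        u ^ (-(1 / 2 - lam + δ) - 1) * Real.exp (-1 / (2 * u)))) ?_ ?_ ?_ ?_
    · refine Eventually.of_forall fun y => Measurable.aestronglyMeasurable ?_
      refine Measurable.indicator ?_ measurableSet_Ioi
      fun_prop
    · filter_upwards [eventually_ge_atTop M] with y hy
      filter_upwards [ae_restrict_mem measurableSet_Ioi] with u hu
      have hu0 : 0 < u := hu
      have hy0 : 0 < y := by linarith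
      by_cases hu1 : M / y < u
      · have hyu : M ≤ y * u := by
          rw [div_lt_iff₀ hy0] at hu1
          linarith [mul_comm u y]
        rw [hform y u hy0 hu1]
        have h1 := hq _ hyu
        have h2 := hpot y (y * u) hy hyu
        rw [show y * u / y = u by field_simp] at h2
        have h3 : 0 ≤ L (y * u) / L y :=
          (div_pos (hL_pos _ (by positivity)) (hL_pos _ hy0)).le
        rw [norm_mul, norm_mul _ (L (y * u) / L y), Real.norm_of_nonneg (by positivity),
          Real.norm_of_nonneg h3, Real.norm_eq_abs]
        have h4 := mul_le_mul h1 h2 h3 (by norm_num)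
        refine (mul_le_mul_of_nonneg_left h4 (by positivity)).trans (le_of_eq ?_)
        rw [show -(1 / 2 - lam - δ) - 1 = (-(1 / 2 - lam) - 1) + δ by ring,
          show -(1 / 2 - lam + δ) - 1 = (-(1 / 2 - lam) - 1) + -δ by ring, Real.rpow_add hu0,
          Real.rpow_add hu0]
        ring
      · simp only [hH]
        rw [Set.indicator_of_notMem (show u ∉ Set.Ioi (M / y) from hu1)]
        simp only [norm_zero]
        positivity
    · exact ((gintble _ (by linarith)).add (gintble _ (by linarith))).const_mul _
    · filter_upwards [ae_restrict_mem measurableSet_Ioi] with u hu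
      have hu0 : 0 < u := hu
      have t1 : Tendsto (fun y : ℝ => y * u) atTop atTop := tendsto_id.atTop_mul_const hu0
      have t2 := hp_tail.comp t1
      have t3 := hL_slow u hu0
      have t4 := (t2.mul t3).const_mul (c * (u ^ (-(1 / 2 - lam) - 1) * Real.exp (-1 / (2 * u))))
      simp only [mul_one] at t4
      refine t4.congr' ?_
      filter_upwards [eventually_gt_atTop 0, eventually_gt_atTop (M / u)] with y hy hy2
      rw [hform y u hy (by rw [div_lt_iff₀ hu0] at hy2; rw [div_lt_iff₀ hy]; linarith [mul_comm u y])]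
      simp only [Function.comp]
      rw [mul_comm u y]
  rw [integral_const_mul, gint _ (by linarith)] at hint
  refine hint.congr' ?_
  filter_upwards [eventually_gt_atTop 0] with y hy
  simp only [hH]
  rw [setIntegral_indicator measurableSet_Ioi, Set.Ioi_inter_Ioi,
    max_eq_right (by positivity : 0 ≤ M / y)]
  have h := integral_comp_mul_left_Ioi (fun σ => (2 * Real.pi * σ) ^ (-(1 : ℝ) / 2) *
    Real.exp (-y / (2 * σ)) * p σ) (M / y) hy
  rw [show y * (M / y) = M by field_simp] at h
  rw [integral_div, integral_mul_const, h, smul_eq_mul]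
  field_simp

lemma partA (lam : ℝ) (L : ℝ → ℝ) (hL_pos : ∀ x : ℝ, 0 < x → 0 < L x)
    (p : ℝ → ℝ) (hp_nonneg : ∀ σ : ℝ, 0 < σ → 0 ≤ p σ)
    (M δ : ℝ) (hM : 1 ≤ M) (hδ : 0 < δ)
    (hpot : ∀ a b, M ≤ a → M ≤ b →
      L b / L a ≤ Real.exp 1 * ((b / a) ^ δ + (b / a) ^ (-δ)))
    (hfin : ∀ y : ℝ, 0 < y → IntegrableOn
      (fun σ : ℝ => (2 * Real.pi * σ) ^ (-(1 : ℝ) / 2) * Real.exp (-y / (2 * σ)) * p σ)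
      (Set.Ioi (0 : ℝ))) :
    Tendsto (fun y : ℝ => (∫ σ in Set.Ioc 0 M,
      (2 * Real.pi * σ) ^ (-(1 : ℝ) / 2) * Real.exp (-y / (2 * σ)) * p σ) /
        (y ^ (lam - 1 / 2) * L y)) atTop (nhds 0) := by
  have hpi := Real.pi_pos
  have hfin' := fun y hy => (hfin y hy).mono_set (show Set.Ioc 0 M ⊆ Set.Ioi 0 from Set.Ioc_subset_Ioi_self)
  set K := ∫ σ in Set.Ioc 0 M,
      (2 * Real.pi * σ) ^ (-(1 : ℝ) / 2) * Real.exp (-1 / (2 * σ)) * p σ with hK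
  have hnn : ∀ y, 0 ≤ ∫ σ in Set.Ioc 0 M,
      (2 * Real.pi * σ) ^ (-(1 : ℝ) / 2) * Real.exp (-y / (2 * σ)) * p σ := by
    intro y
    refine setIntegral_nonneg measurableSet_Ioc fun σ hσ => ?_
    have := hp_nonneg σ hσ.1
    have := hσ.1
    positivity
  have hK0 : 0 ≤ K := hnn 1
  have hLM := hL_pos M (by linarith)
  have hbd := (tendsto_rpow_mul_exp_neg_mul_atTop_nhds_zero (1 / 2 - lam + δ) (1 / (2 * M))
    (by positivity)).const_mul (K * Real.exp (1 / (2 * M)) * (2 * Real.exp 1 / L M))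
  rw [mul_zero] at hbd
  refine squeeze_zero' ?_ ?_ hbd
  · filter_upwards [eventually_gt_atTop 0] with y hy
    have := hL_pos y hy
    have := hnn y
    positivity
  · filter_upwards [eventually_ge_atTop M] with y hy
    have hy1 : 1 ≤ y := hM.trans hy
    have hy0 : 0 < y := by linarith
    have hM0 : 0 < M := by linarith
    have hLy := hL_pos y hy0
    have b1 : (∫ σ in Set.Ioc 0 M,
        (2 * Real.pi * σ) ^ (-(1 : ℝ) / 2) * Real.exp (-y / (2 * σ)) * p σ) ≤
        Real.exp (-(y - 1) / (2 * M)) * K := by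
      rw [hK, ← integral_const_mul]
      refine setIntegral_mono_on (hfin' y hy0) ((hfin' 1 one_pos).const_mul _) measurableSet_Ioc ?_
      intro σ hσ
      have hσ0 := hσ.1
      have := hp_nonneg σ hσ0
      have e : Real.exp (-y / (2 * σ)) ≤ Real.exp (-(y - 1) / (2 * M)) * Real.exp (-1 / (2 * σ)) := by
        rw [← Real.exp_add]
        refine Real.exp_le_exp.2 ?_
        have : (y - 1) / (2 * M) ≤ (y - 1) / (2 * σ) :=
          div_le_div_of_nonneg_left (by linarith) (by linarith) (by linarith [hσ.2])
        have e2 : -y / (2 * σ) = -((y - 1) / (2 * σ)) + -1 / (2 * σ) := by field_simp; ring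
        rw [e2, neg_div (2 * M)]
        linarith
      calc _ ≤ (2 * Real.pi * σ) ^ (-(1 : ℝ) / 2) *
            (Real.exp (-(y - 1) / (2 * M)) * Real.exp (-1 / (2 * σ))) * p σ := by gcongr
        _ = _ := by ring
    have b2 : 1 / L y ≤ 2 * Real.exp 1 / L M * y ^ δ := by
      have h := hpot y M hy le_rfl
      have h1 : (M / y) ^ δ ≤ y ^ δ := by
        refine (Real.rpow_le_one (by positivity) ((div_le_one hy0).2 hy) hδ.le).trans ?_
        exact Real.one_le_rpow hy1 hδ.le
      have h2 : (M / y) ^ (-δ) ≤ y ^ δ := by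
        rw [Real.rpow_neg (by positivity), ← Real.inv_rpow (by positivity), inv_div]
        exact Real.rpow_le_rpow (by positivity) (div_le_self hy0.le hM) hδ.le
      have h3 : L M / L y ≤ Real.exp 1 * (y ^ δ + y ^ δ) :=
        h.trans (mul_le_mul_of_nonneg_left (add_le_add h1 h2) (Real.exp_pos 1).le)
      calc 1 / L y = (L M / L y) / L M := by field_simp
        _ ≤ Real.exp 1 * (y ^ δ + y ^ δ) / L M := by gcongr
        _ = _ := by ring
    calc _ = (∫ σ in Set.Ioc 0 M,
        (2 * Real.pi * σ) ^ (-(1 : ℝ) / 2) * Real.exp (-y / (2 * σ)) * p σ) *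
          (y ^ (1 / 2 - lam) * (1 / L y)) := by
          rw [show (1 / 2 - lam) = -(lam - 1 / 2) by ring, Real.rpow_neg hy0.le]
          have := Real.rpow_pos_of_pos hy0 (lam - 1 / 2)
          field_simp
      _ ≤ (Real.exp (-(y - 1) / (2 * M)) * K) *
          (y ^ (1 / 2 - lam) * (2 * Real.exp 1 / L M * y ^ δ)) := by gcongr
      _ = _ := by
          rw [Real.rpow_add hy0, show -(y - 1) / (2 * M) = 1 / (2 * M) + -(1 / (2 * M)) * y by
            field_simp; ring, Real.exp_add]
          ring

/-- Barndorff-Nielsen–Kent–Sørensen tail behavior of a normal scale mixture whose mixing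
density is regularly varying (the `ψ₊ = 0` case): if `p(σ) ~ σ^(λ-1) L(σ)` as `σ → ∞` with
`L` slowly varying and `λ < 1/2`, then
`g(x) ~ (2π)^(-1/2) 2^(1/2-λ) Γ(1/2-λ) |x|^(2λ-1) L(x²)` as `|x| → ∞`. -/
theorem normal_scale_mixture_tail (lam : ℝ) (hlam : lam < 1 / 2)
    (L : ℝ → ℝ) (hL_meas : Measurable L) (hL_pos : ∀ x : ℝ, 0 < x → 0 < L x)
    (hL_slow : ∀ t : ℝ, 0 < t → Tendsto (fun x : ℝ => L (t * x) / L x) atTop (nhds 1))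
    (p : ℝ → ℝ) (hp_meas : Measurable p) (hp_nonneg : ∀ σ : ℝ, 0 < σ → 0 ≤ p σ)
    (hp_tail : Tendsto (fun σ : ℝ => p σ / (σ ^ (lam - 1) * L σ)) atTop (nhds 1))
    (g : ℝ → ℝ)
    (hg : ∀ x : ℝ, g x = ∫ σ in Set.Ioi (0 : ℝ),
      (2 * Real.pi * σ) ^ (-(1 : ℝ) / 2) * Real.exp (-x ^ 2 / (2 * σ)) * p σ)
    (hfin : ∀ x : ℝ, x ≠ 0 → IntegrableOn
      (fun σ : ℝ => (2 * Real.pi * σ) ^ (-(1 : ℝ) / 2) * Real.exp (-x ^ 2 / (2 * σ)) * p σ)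
      (Set.Ioi (0 : ℝ))) :
    Tendsto (fun x : ℝ => g x /
        ((2 * Real.pi) ^ (-(1 : ℝ) / 2) * 2 ^ ((1 : ℝ) / 2 - lam) *
          Real.Gamma (1 / 2 - lam) * |x| ^ (2 * lam - 1) * L (x ^ 2)))
      (atBot ⊔ atTop) (nhds 1) := by
  obtain ⟨X, hX1, hX⟩ := potter L hL_meas hL_pos hL_slow ((1 / 2 - lam) / 2) (by linarith)
  obtain ⟨X2, hX2⟩ := eventually_atTop.1
    (hp_tail.abs.eventually (gt_mem_nhds (show |(1:ℝ)| < 2 by norm_num)))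
  have hM : 1 ≤ max X X2 := hX1.trans (le_max_left _ _)
  have hpot : ∀ a b, max X X2 ≤ a → max X X2 ≤ b → L b / L a ≤
      Real.exp 1 * ((b / a) ^ ((1 / 2 - lam) / 2) + (b / a) ^ (-((1 / 2 - lam) / 2))) :=
    fun a b ha hb => hX a b ((le_max_left _ _).trans ha) ((le_max_left _ _).trans hb)
  have hfin2 : ∀ y : ℝ, 0 < y → IntegrableOn
      (fun σ : ℝ => (2 * Real.pi * σ) ^ (-(1 : ℝ) / 2) * Real.exp (-y / (2 * σ)) * p σ)
      (Set.Ioi (0 : ℝ)) := by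
    intro y hy
    have := hfin (Real.sqrt y) (Real.sqrt_pos.2 hy).ne'
    rwa [Real.sq_sqrt hy.le] at this
  have hB := partB lam L hL_pos hL_slow p hp_meas hp_tail (max X X2) ((1 / 2 - lam) / 2) hM
    (by linarith) (by linarith) (fun σ hσ => (hX2 σ ((le_max_right _ _).trans hσ)).le) hpot
  have hA := partA lam L hL_pos p hp_nonneg (max X X2) ((1 / 2 - lam) / 2) hM
    (by linarith) hpot hfin2
  have hD : 0 < (2 * Real.pi) ^ (-(1 : ℝ) / 2) *
        (2 ^ ((1 : ℝ) / 2 - lam) * Real.Gamma (1 / 2 - lam)) := by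
    have := Real.Gamma_pos_of_pos (show 0 < 1 / 2 - lam by linarith)
    have := Real.pi_pos
    positivity
  have hAB := (hA.add hB).div_const ((2 * Real.pi) ^ (-(1 : ℝ) / 2) *
        (2 ^ ((1 : ℝ) / 2 - lam) * Real.Gamma (1 / 2 - lam)))
  rw [zero_add, div_self hD.ne'] at hAB
  have hsq : Tendsto (fun x : ℝ => x ^ 2) (atBot ⊔ atTop) atTop := by
    refine Tendsto.sup ?_ (tendsto_pow_atTop (by norm_num))
    have := (tendsto_pow_atTop (α := ℝ) (n := 2) (by norm_num)).comp tendsto_neg_atBot_atTop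
    refine this.congr fun x => ?_
    simp
  refine (hAB.comp hsq).congr' ?_
  filter_upwards [hsq.eventually (eventually_gt_atTop 0)] with x hx
  simp only [Function.comp]
  rw [hg x, ← Set.Ioc_union_Ioi_eq_Ioi (show (0:ℝ) ≤ max X X2 by linarith),
    setIntegral_union (Set.Ioc_disjoint_Ioi le_rfl) measurableSet_Ioi
      ((hfin2 _ hx).mono_set Set.Ioc_subset_Ioi_self)
      ((hfin2 _ hx).mono_set (Set.Ioi_subset_Ioi (by linarith))),
    show |x| ^ (2 * lam - 1) = (x ^ 2) ^ (lam - 1 / 2) by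
      rw [← sq_abs, ← Real.rpow_natCast, ← Real.rpow_mul (abs_nonneg x)]; congr 1; push_cast; ring,
    ← add_div, div_div]
  congr 1
  ring
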